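/- Let a₁ < b₁ and a₂ < b₂ be real numbers with min-max normalizations L₁(x) = (x − a₁)/(b₁ − a₁) and L₂(x) = (x − a₂)/(b₂ − a₂), and let λ ∈ (0, 1). Define λ' = λ(b₁ − a₁) / (λ(b₁ − a₁) + (1 − λ)(b₂ − a₂)). Then λ' ∈ (0, 1), and for any type ι and any functions f₁, f₂ : ι → ℝ, an element i ∈ ι maximizes the function j ↦ λ·f₁(j) + (1 − λ)·f₂(j) over ι if and only if i maximizes the function j ↦ λ'·L₁(f₁(j)) + (1 − λ')·L₂(f₂(j)) over ι. -/

import Mathlib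

/-- Equivalence of combining raw objectives versus individually min-max normalized
objectives: with `λ' = λ(b₁-a₁) / (λ(b₁-a₁) + (1-λ)(b₂-a₂))` one has `λ' ∈ (0,1)`, and `i`
maximizes `j ↦ λ f₁ j + (1-λ) f₂ j` iff `i` maximizes
`j ↦ λ' L₁ (f₁ j) + (1-λ') L₂ (f₂ j)`. -/
theorem argmax_raw_iff_argmax_normalized
    {ι : Type*} (a₁ b₁ a₂ b₂ : ℝ) (h₁ : a₁ < b₁) (h₂ : a₂ < b₂)
    (L₁ L₂ : ℝ → ℝ)
    (hL₁ : ∀ x, L₁ x = (x - a₁) / (b₁ - a₁))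
    (hL₂ : ∀ x, L₂ x = (x - a₂) / (b₂ - a₂))
    (l : ℝ) (hl : l ∈ Set.Ioo (0 : ℝ) 1)
    (l' : ℝ) (hl' : l' = l * (b₁ - a₁) / (l * (b₁ - a₁) + (1 - l) * (b₂ - a₂)))
    (f₁ f₂ : ι → ℝ) (i : ι) :
    l' ∈ Set.Ioo (0 : ℝ) 1 ∧
    ((∀ j : ι, l * f₁ j + (1 - l) * f₂ j ≤ l * f₁ i + (1 - l) * f₂ i) ↔
      (∀ j : ι, l' * L₁ (f₁ j) + (1 - l') * L₂ (f₂ j) ≤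
        l' * L₁ (f₁ i) + (1 - l') * L₂ (f₂ i))) := by
  obtain ⟨hl0, hl1⟩ := hl
  have p1 : 0 < b₁ - a₁ := sub_pos.mpr h₁
  have p2 : 0 < b₂ - a₂ := sub_pos.mpr h₂
  have q : 0 < 1 - l := sub_pos.mpr hl1
  have m1 : 0 < l * (b₁ - a₁) := mul_pos hl0 p1
  have m2 : 0 < (1 - l) * (b₂ - a₂) := mul_pos q p2
  obtain ⟨D, hD⟩ : ∃ D, D = l * (b₁ - a₁) + (1 - l) * (b₂ - a₂) := ⟨_, rfl⟩
  have hDpos : 0 < D := by rw [hD]; exact add_pos m1 m2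
  rw [← hD] at hl'
  have e2 : 1 - l' = (1 - l) * (b₂ - a₂) / D := by
    rw [hl', eq_div_iff hDpos.ne', sub_mul, div_mul_cancel₀ _ hDpos.ne', hD]
    ring
  have key : ∀ j, l' * L₁ (f₁ j) + (1 - l') * L₂ (f₂ j)
      = (l * f₁ j + (1 - l) * f₂ j - (l * a₁ + (1 - l) * a₂)) / D := by
    intro j
    have hp1 := p1.ne'
    have hp2 := p2.ne'
    have hd := hDpos.ne'
    rw [e2, hl', hL₁, hL₂]
    clear hD e2 hl'
    field_simp
    ring
  refine ⟨⟨?_, ?_⟩, ?_⟩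
  · rw [hl']; exact div_pos m1 hDpos
  · have : 0 < 1 - l' := by rw [e2]; exact div_pos m2 hDpos
    linarith
  · refine forall_congr' fun j => ?_
    rw [key, key, div_le_div_iff_of_pos_right hDpos, sub_le_sub_iff_right]
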